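/- Under assumptions (A1)–(A3), for any ε > 0 and any compact set K ⊆ M_1(Z), there exists T_0 < ∞ such that for any ν, ξ ∈ K there exist T ≤ T_0 and an absolutely continuous path μ : [0,T] → M_1(Z) with μ(0) = ν, μ(T) = ξ, and S_{[0,T]}(μ|ν) ≤ V(ξ|ν) + ε. -/

import Mathlib

open MeasureTheory Set ENNReal Filter

noncomputable section

/-- The Legendre conjugate `τ*(u) = (u+1)·log(u+1) − u`.  Since `Real.log 0 = 0`
in Mathlib, this gives `τ*(-1) = 1`, matching the convention of the paper; the
value for `u < -1` is irrelevant since all arguments below are `≥ -1`. -/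
def tauStar (u : ℝ) : ℝ := (u + 1) * Real.log (u + 1) - u

/-- The mean field model: state space `Fin r`, directed edge set `E` without
self-loops, and transition rate functions `lam i j`, together with assumptions
(A1) (irreducibility), (A2) (Lipschitz rates) and (A3) (rates on edges bounded
below by `c > 0`); `Cb` is the upper bound on the rates (a consequence of
(A2) and compactness of the simplex). -/
structure MeanFieldModel (r : ℕ) where
  E : Finset (Fin r × Fin r)
  no_diag : ∀ i : Fin r, (i, i) ∉ E
  /-- (A1): the directed graph `(Z, E)` is irreducible. -/
  irreducible : ∀ i j : Fin r, Relation.ReflTransGen (fun a b => (a, b) ∈ E) i j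
  lam : Fin r → Fin r → (Fin r → ℝ) → ℝ
  /-- (A2): each rate function is Lipschitz on the simplex. -/
  lam_lipschitz : ∀ p ∈ E, ∃ K : NNReal, LipschitzOnWith K (lam p.1 p.2) (stdSimplex ℝ (Fin r))
  c : ℝ
  c_pos : 0 < c
  /-- (A3): rates of admissible jumps are uniformly bounded away from zero. -/
  lam_lower : ∀ p ∈ E, ∀ μ ∈ stdSimplex ℝ (Fin r), c ≤ lam p.1 p.2 μ
  /-- rates vanish off the edge set -/
  lam_off : ∀ i j : Fin r, i ≠ j → (i, j) ∉ E → ∀ μ : Fin r → ℝ, lam i j μ = 0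
  /-- diagonal convention `λ_{i,i} = −Σ_{j≠i} λ_{i,j}` -/
  lam_diag : ∀ i : Fin r, ∀ μ : Fin r → ℝ,
    lam i i μ = -∑ j ∈ Finset.univ.filter (fun j => j ≠ i), lam i j μ
  Cb : ℝ
  /-- upper bound on the rates -/
  lam_upper : ∀ p ∈ E, ∀ μ ∈ stdSimplex ℝ (Fin r), lam p.1 p.2 μ ≤ Cb

variable {r : ℕ}

/-- A time-varying rate matrix `L(t)` adapted to the model: measurable entries,
nonnegative off-diagonal entries, entries vanishing off the edge set, and the
diagonal convention `l_{i,i}(t) = −Σ_{j≠i} l_{i,j}(t)`. -/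
def IsRateMatrix (M : MeanFieldModel r) (L : ℝ → Fin r → Fin r → ℝ) : Prop :=
  (∀ i j : Fin r, Measurable fun t => L t i j) ∧
  (∀ t : ℝ, ∀ i j : Fin r, i ≠ j → 0 ≤ L t i j) ∧
  (∀ t : ℝ, ∀ i j : Fin r, i ≠ j → (i, j) ∉ M.E → L t i j = 0) ∧
  (∀ t : ℝ, ∀ i : Fin r,
    L t i i = -∑ j ∈ Finset.univ.filter (fun j => j ≠ i), L t i j)

/-- `μ` is absolutely continuous on `[0,T]` with `μ̇(t) = L(t)ᵀ μ(t)` a.e.,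
expressed in integral form:  `μ(t) = μ(0) + ∫_0^t L(s)ᵀ μ(s) ds`. -/
def SolvesODE (L : ℝ → Fin r → Fin r → ℝ) (μ : ℝ → Fin r → ℝ) (T : ℝ) : Prop :=
  (∀ i : Fin r, IntegrableOn (fun t => ∑ j, L t j i * μ t j) (Icc 0 T)) ∧
  ∀ t ∈ Icc (0 : ℝ) T, ∀ i : Fin r,
    μ t i = μ 0 i + ∫ s in Ioc (0 : ℝ) t, ∑ j, L s j i * μ s j

/-- `μ` is absolutely continuous on `[0,∞)` with `μ̇(t) = −L(t)ᵀ μ(t)` a.e.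
(reversed-time dynamics), in integral form. -/
def SolvesReversedODE (L : ℝ → Fin r → Fin r → ℝ) (μ : ℝ → Fin r → ℝ) : Prop :=
  (∀ T : ℝ, 0 < T → ∀ i : Fin r,
    IntegrableOn (fun t => ∑ j, L t j i * μ t j) (Icc 0 T)) ∧
  ∀ t : ℝ, 0 ≤ t → ∀ i : Fin r,
    μ t i = μ 0 i - ∫ s in Ioc (0 : ℝ) t, ∑ j, L s j i * μ s j

/-- The running cost
`I_{[0,T]}(μ, L) = ∫_0^T Σ_{(i,j)∈E} μ(t)(i) λ_{i,j}(μ(t)) τ*( l_{i,j}(t)/λ_{i,j}(μ(t)) − 1 ) dt`. -/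
def runningCost (M : MeanFieldModel r) (μ : ℝ → Fin r → ℝ)
    (L : ℝ → Fin r → Fin r → ℝ) (T : ℝ) : ℝ≥0∞ :=
  ∫⁻ t in Ioc (0 : ℝ) T, ENNReal.ofReal (∑ p ∈ M.E,
    μ t p.1 * M.lam p.1 p.2 (μ t) * tauStar (L t p.1 p.2 / M.lam p.1 p.2 (μ t) - 1))

/-- The infinite-horizon running cost on `[0, ∞)`. -/
def runningCostInf (M : MeanFieldModel r) (μ : ℝ → Fin r → ℝ)
    (L : ℝ → Fin r → Fin r → ℝ) : ℝ≥0∞ :=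
  ∫⁻ t in Ioi (0 : ℝ), ENNReal.ofReal (∑ p ∈ M.E,
    μ t p.1 * M.lam p.1 p.2 (μ t) * tauStar (L t p.1 p.2 / M.lam p.1 p.2 (μ t) - 1))

/-- `S_{[0,T]}(μ | ν)`: the infimum of the running cost over all time-varying
rate matrices `L` with `μ̇ = Lᵀ μ` a.e., provided `μ(0) = ν`, `μ` is absolutely
continuous and takes values in `M₁(Z)`; `+∞` otherwise (the infimum over an
empty family being `⊤`). -/
def SPath (M : MeanFieldModel r) (T : ℝ) (ν : Fin r → ℝ) (μ : ℝ → Fin r → ℝ) : ℝ≥0∞ :=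
  ⨅ (L : ℝ → Fin r → Fin r → ℝ)
    (_ : IsRateMatrix M L ∧ SolvesODE L μ T ∧ μ 0 = ν ∧
      ∀ t ∈ Icc (0 : ℝ) T, μ t ∈ stdSimplex ℝ (Fin r)),
    runningCost M μ L T

/-- `S_T(ξ | ν) = inf { S_{[0,T]}(μ|ν) : μ(0) = ν, μ(T) = ξ }`. -/
def SEnd (M : MeanFieldModel r) (T : ℝ) (ν ξ : Fin r → ℝ) : ℝ≥0∞ :=
  ⨅ (μ : ℝ → Fin r → ℝ) (_ : μ 0 = ν ∧ μ T = ξ), SPath M T ν μ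

/-- The quasipotential `V(ξ | ν) = inf_{T > 0} S_T(ξ | ν)`. -/
def quasipotential (M : MeanFieldModel r) (ν ξ : Fin r → ℝ) : ℝ≥0∞ :=
  ⨅ (T : ℝ) (_ : 0 < T), SEnd M T ν ξ

/-- Equivalence of points: `ν ∼ ξ` iff `V(ξ|ν) = V(ν|ξ) = 0`. -/
def VEquiv (M : MeanFieldModel r) (ν ξ : Fin r → ℝ) : Prop :=
  quasipotential M ν ξ = 0 ∧ quasipotential M ξ ν = 0

/-- `s` satisfies the dynamic programming equation
`s(ξ) = inf_{ν ∈ M₁(Z)} [ s(ν) + S_T(ξ|ν) ]` for every `T > 0`. -/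
def SatisfiesDPE (M : MeanFieldModel r) (s : (Fin r → ℝ) → ℝ) : Prop :=
  ∀ T : ℝ, 0 < T → ∀ ξ ∈ stdSimplex ℝ (Fin r),
    ENNReal.ofReal (s ξ) =
      ⨅ ν ∈ stdSimplex ℝ (Fin r), (ENNReal.ofReal (s ν) + SEnd M T ν ξ)

/-- A solution of the McKean–Vlasov equation `μ̇(t) = A_{μ(t)}ᵀ μ(t)` on `[0,∞)`,
as a path in `M₁(Z)`, in integral form. -/
def IsMVSolution (M : MeanFieldModel r) (η : ℝ → Fin r → ℝ) : Prop :=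
  (∀ t : ℝ, 0 ≤ t → η t ∈ stdSimplex ℝ (Fin r)) ∧
  (∀ T : ℝ, 0 < T → ∀ i : Fin r,
    IntegrableOn (fun t => ∑ j, M.lam j i (η t) * η t j) (Icc 0 T)) ∧
  ∀ t : ℝ, 0 ≤ t → ∀ i : Fin r,
    η t i = η 0 i + ∫ s in Ioc (0 : ℝ) t, ∑ j, M.lam j i (η s) * η s j

/-- A solution of the time-reversed McKean–Vlasov equation
`η̇(t) = −A_{η(t)}ᵀ η(t)` on `[0,∞)`, in integral form. -/
def IsReversedMVSolution (M : MeanFieldModel r) (η : ℝ → Fin r → ℝ) : Prop :=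
  (∀ T : ℝ, 0 < T → ∀ i : Fin r,
    IntegrableOn (fun t => ∑ j, M.lam j i (η t) * η t j) (Icc 0 T)) ∧
  ∀ t : ℝ, 0 ≤ t → ∀ i : Fin r,
    η t i = η 0 i - ∫ s in Ioc (0 : ℝ) t, ∑ j, M.lam j i (η s) * η s j

/-- `ξ₀` is the unique globally asymptotically stable equilibrium of the
McKean–Vlasov equation: `A_{ξ₀}ᵀ ξ₀ = 0` and every solution with initial
condition in `M₁(Z)` converges to `ξ₀`. -/
def IsUniqueGASEquilibrium (M : MeanFieldModel r) (ξ₀ : Fin r → ℝ) : Prop :=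
  ξ₀ ∈ stdSimplex ℝ (Fin r) ∧
  (∀ i : Fin r, ∑ j, M.lam j i ξ₀ * ξ₀ j = 0) ∧
  ∀ η : ℝ → Fin r → ℝ, IsMVSolution M η → Tendsto η atTop (nhds ξ₀)

/-- The ω-limit set of a path: `Ω = ∩_{t>0} closure { μ(t') : t' ≥ t }`. -/
def omegaSet (η : ℝ → Fin r → ℝ) : Set (Fin r → ℝ) :=
  ⋂ t ∈ Ioi (0 : ℝ), closure (η '' Ici t)

/-- Assumption (B): finitely many compact subsets `K 1, …, K l` of `M₁(Z)` such
that any two points of the same `K i` are equivalent, no point of `K i` is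
equivalent to a point of `M₁(Z)` outside `K i`, and every ω-limit set of the
McKean–Vlasov equation is contained in some `K i`. -/
def AssumptionB (M : MeanFieldModel r) (l : ℕ) (K : Fin l → Set (Fin r → ℝ)) : Prop :=
  (∀ i, IsCompact (K i)) ∧
  (∀ i, K i ⊆ stdSimplex ℝ (Fin r)) ∧
  (∀ i, ∀ ν ∈ K i, ∀ ξ ∈ K i, VEquiv M ν ξ) ∧
  (∀ i, ∀ ν ∈ K i, ∀ ξ ∈ stdSimplex ℝ (Fin r), ξ ∉ K i → ¬ VEquiv M ν ξ) ∧
  (∀ η : ℝ → Fin r → ℝ, IsMVSolution M η → ∃ i, omegaSet η ⊆ K i)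

/-- `μ` is continuous and piecewise linear on `[0,T]`, with constant velocity on
each linear segment (linear interpolation between the breakpoints). -/
def PiecewiseLinear (μ : ℝ → Fin r → ℝ) (T : ℝ) : Prop :=
  ∃ (n : ℕ) (t : Fin (n + 1) → ℝ), StrictMono t ∧ t 0 = 0 ∧ t (Fin.last n) = T ∧
    ∀ k : Fin n, ∀ u ∈ Icc (t k.castSucc) (t k.succ), ∀ i : Fin r,
      μ u i = μ (t k.castSucc) i +
        (u - t k.castSucc) / (t k.succ - t k.castSucc) *
          (μ (t k.succ) i - μ (t k.castSucc) i)

end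

/-- connection predicate -/
def Conn (M : MeanFieldModel r) (T : ℝ) (ν ξ : Fin r → ℝ) (a : ℝ≥0∞) : Prop :=
  ∃ (μ : ℝ → Fin r → ℝ) (L : ℝ → Fin r → Fin r → ℝ), IsRateMatrix M L ∧ SolvesODE L μ T ∧
    μ 0 = ν ∧ μ T = ξ ∧ (∀ t ∈ Icc (0 : ℝ) T, μ t ∈ stdSimplex ℝ (Fin r)) ∧
    runningCost M μ L T ≤ a

theorem Conn.mono {M : MeanFieldModel r} {T : ℝ} {ν ξ : Fin r → ℝ} {a b : ℝ≥0∞}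
    (h : Conn M T ν ξ a) (hab : a ≤ b) : Conn M T ν ξ b := by
  obtain ⟨μ, L, h1, h2, h3, h4, h5, h6⟩ := h
  exact ⟨μ, L, h1, h2, h3, h4, h5, h6.trans hab⟩

theorem Conn.path {M : MeanFieldModel r} {T : ℝ} {ν ξ : Fin r → ℝ} {a : ℝ≥0∞}
    (h : Conn M T ν ξ a) : ∃ μ : ℝ → Fin r → ℝ, μ 0 = ν ∧ μ T = ξ ∧ SPath M T ν μ ≤ a := by
  obtain ⟨μ, L, h1, h2, h3, h4, h5, h6⟩ := h
  refine ⟨μ, h3, h4, ?_⟩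
  unfold SPath
  exact (iInf₂_le L ⟨h1, h2, h3, h5⟩).trans h6

theorem Conn.quasi_le {M : MeanFieldModel r} {T : ℝ} {ν ξ : Fin r → ℝ} {a : ℝ≥0∞}
    (h : Conn M T ν ξ a) (hT : 0 < T) : quasipotential M ν ξ ≤ a := by
  obtain ⟨μ, h1, h2, h3⟩ := h.path
  unfold quasipotential SEnd
  exact (iInf₂_le T hT).trans ((iInf₂_le μ ⟨h1, h2⟩).trans h3)

theorem conn_of_quasi_lt {M : MeanFieldModel r} {ν ξ : Fin r → ℝ} {a : ℝ≥0∞}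
    (h : quasipotential M ν ξ < a) : ∃ T, 0 < T ∧ Conn M T ν ξ a := by
  unfold quasipotential SEnd SPath at h
  simp only [iInf_lt_iff] at h
  obtain ⟨T, hT, μ, ⟨h1, h2⟩, L, ⟨h3, h4, h5, h6⟩, h7⟩ := h
  exact ⟨T, hT, μ, L, h3, h4, h5, h2, h6, h7.le⟩

theorem Conn.trans {M : MeanFieldModel r} {T₁ T₂ : ℝ} {ν η ξ : Fin r → ℝ} {a b : ℝ≥0∞}
    (h : Conn M T₁ ν η a) (h' : Conn M T₂ η ξ b) (hT₁ : 0 < T₁) (hT₂ : 0 < T₂) :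
    Conn M (T₁ + T₂) ν ξ (a + b) := by
  obtain ⟨μ₁, L₁, ⟨r1, r2, r3, r4⟩, ⟨i1, o1⟩, s1, e1, p1, c1⟩ := h
  obtain ⟨μ₂, L₂, ⟨q1, q2, q3, q4⟩, ⟨i2, o2⟩, s2, e2, p2, c2⟩ := h'
  set μ : ℝ → Fin r → ℝ := fun t => if t ≤ T₁ then μ₁ t else μ₂ (t - T₁) with hμ
  set L : ℝ → Fin r → Fin r → ℝ := fun t => if t ≤ T₁ then L₁ t else L₂ (t - T₁) with hL
  have m1 : ∀ t, t ≤ T₁ → μ t = μ₁ t := fun t ht => by simp [hμ, ht]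
  have m2 : ∀ t, T₁ < t → μ t = μ₂ (t - T₁) := fun t ht => by simp [hμ, not_le.2 ht]
  have l1 : ∀ t, t ≤ T₁ → L t = L₁ t := fun t ht => by simp [hL, ht]
  have l2 : ∀ t, T₁ < t → L t = L₂ (t - T₁) := fun t ht => by simp [hL, not_le.2 ht]
  have mp : MeasurePreserving (fun t : ℝ => t - T₁) volume volume :=
    measurePreserving_sub_right volume T₁
  have me : MeasurableEmbedding (fun t : ℝ => t - T₁) :=
    (MeasurableEquiv.subRight T₁).measurableEmbedding
  have pre : ∀ s, (fun t : ℝ => t - T₁) ⁻¹' (Ioc 0 s) = Ioc T₁ (T₁ + s) := by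
    intro s; ext x; simp only [mem_preimage, mem_Ioc]; constructor <;> rintro ⟨h1, h2⟩ <;>
      constructor <;> linarith
  have ii1 : ∀ i, IntegrableOn (fun t => ∑ j, L t j i * μ t j) (Ioc 0 T₁) := by
    intro i
    refine ((i1 i).mono_set Ioc_subset_Icc_self).congr_fun ?_ measurableSet_Ioc
    intro t ht
    simp only [m1 t ht.2, l1 t ht.2]
  have ii2 : ∀ i, IntegrableOn (fun t => ∑ j, L t j i * μ t j) (Ioc T₁ (T₁ + T₂)) := by
    intro i
    have := (i2 i).mono_set (Ioc_subset_Icc_self)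
    rw [← mp.integrableOn_comp_preimage me, pre] at this
    refine this.congr_fun ?_ measurableSet_Ioc
    intro t ht
    simp only [m2 t ht.1, l2 t ht.1, Function.comp]
  have v1 : ∀ t ≤ T₁, ∀ i, ∫ s in Ioc (0 : ℝ) t, ∑ j, L s j i * μ s j
      = ∫ s in Ioc (0 : ℝ) t, ∑ j, L₁ s j i * μ₁ s j := by
    intro t ht i
    refine setIntegral_congr_fun measurableSet_Ioc ?_
    intro s hs
    simp only [m1 s (hs.2.trans ht), l1 s (hs.2.trans ht)]
  have v2 : ∀ t, ∀ i, ∫ s in Ioc T₁ (T₁ + t), ∑ j, L s j i * μ s j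
      = ∫ s in Ioc (0 : ℝ) t, ∑ j, L₂ s j i * μ₂ s j := by
    intro t i
    rw [← mp.setIntegral_preimage_emb me _ (Ioc 0 t), pre]
    refine setIntegral_congr_fun measurableSet_Ioc ?_
    intro s hs
    simp only [m2 s hs.1, l2 s hs.1]
  refine ⟨μ, L, ⟨?_, ?_, ?_, ?_⟩, ⟨?_, ?_⟩, ?_, ?_, ?_, ?_⟩
  · intro i j
    have : (fun t => L t i j) = fun t => if t ≤ T₁ then L₁ t i j else L₂ (t - T₁) i j := by
      funext t; simp only [hL]; split_ifs <;> rfl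
    rw [this]
    exact Measurable.ite measurableSet_Iic (r1 i j) ((q1 i j).comp (measurable_id.sub_const T₁))
  · intro t i j hij
    rcases le_or_gt t T₁ with ht | ht
    · rw [l1 t ht]; exact r2 t i j hij
    · rw [l2 t ht]; exact q2 _ i j hij
  · intro t i j hij hE
    rcases le_or_gt t T₁ with ht | ht
    · rw [l1 t ht]; exact r3 t i j hij hE
    · rw [l2 t ht]; exact q3 _ i j hij hE
  · intro t i
    rcases le_or_gt t T₁ with ht | ht
    · rw [l1 t ht]; exact r4 t i
    · rw [l2 t ht]; exact q4 _ i
  · intro i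
    rw [integrableOn_Icc_iff_integrableOn_Ioc]
    have := (ii1 i).union (ii2 i)
    rwa [Ioc_union_Ioc_eq_Ioc hT₁.le (by linarith)] at this
  · intro t ht i
    rw [m1 0 hT₁.le]
    rcases le_or_gt t T₁ with ht' | ht'
    · rw [v1 t ht' i, m1 t ht']
      exact o1 t ⟨ht.1, ht'⟩ i
    · rw [m2 t ht', o2 (t - T₁) ⟨by linarith, by linarith [ht.2]⟩ i, s2, ← e1,
        o1 T₁ ⟨hT₁.le, le_rfl⟩ i, ← v1 T₁ le_rfl i, ← v2,
        ← Ioc_union_Ioc_eq_Ioc hT₁.le ht'.le]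
      have hs : T₁ + (t - T₁) = t := by ring
      rw [hs, setIntegral_union (Ioc_disjoint_Ioc_of_le le_rfl) measurableSet_Ioc (ii1 i)
        ((ii2 i).mono_set (Ioc_subset_Ioc_right ht.2))]
      ring
  · rw [m1 0 hT₁.le, s1]
  · rw [m2 _ (by linarith), ← e2]; congr 1; ring
  · intro t ht
    rcases le_or_gt t T₁ with ht' | ht'
    · rw [m1 t ht']; exact p1 t ⟨ht.1, ht'⟩
    · rw [m2 t ht']; exact p2 _ ⟨by linarith, by linarith [ht.2]⟩
  · refine le_trans ?_ (add_le_add c1 c2)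
    unfold runningCost
    rw [← Ioc_union_Ioc_eq_Ioc hT₁.le (by linarith : T₁ ≤ T₁ + T₂)]
    refine (lintegral_union_le _ _ _).trans (add_le_add (le_of_eq ?_) (le_of_eq ?_))
    · refine setLIntegral_congr_fun measurableSet_Ioc ?_
      intro t ht
      simp only [m1 t ht.2, l1 t ht.2]
    · rw [← mp.setLIntegral_comp_preimage_emb me _ (Ioc 0 T₂), pre]
      refine setLIntegral_congr_fun measurableSet_Ioc ?_
      intro t ht
      simp only [m2 t ht.1, l2 t ht.1]

theorem exists_unitflow (M : MeanFieldModel r) (a b : Fin r) :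
    ∃ N : Fin r → Fin r → ℝ, (∀ i j, 0 ≤ N i j) ∧ (∀ i j, (i, j) ∉ M.E → N i j = 0) ∧
      ∀ k, ∑ i, N i k - ∑ j, N k j = (if k = b then 1 else 0) - (if k = a then 1 else 0) := by
  induction M.irreducible a b with
  | refl => exact ⟨fun _ _ => 0, by simp, by simp, by simp⟩
  | @tail b c _ hbc ih =>
    obtain ⟨N, h1, h2, h3⟩ := ih
    refine ⟨fun i j => N i j + (if i = b then (1 : ℝ) else 0) * (if j = c then 1 else 0), ?_, ?_, ?_⟩
    · intro i j
      have := h1 i j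
      dsimp only
      split_ifs <;> linarith
    · intro i j hij
      dsimp only
      rw [h2 i j hij]
      by_cases hi : i = b
      · by_cases hj : j = c
        · subst hi; subst hj; exact absurd hbc hij
        · simp [hj]
      · simp [hi]
    · intro k
      have := h3 k
      simp only [Finset.sum_add_distrib, ← Finset.sum_mul, ← Finset.mul_sum]
      simp only [Finset.sum_ite_eq', Finset.mem_univ, if_true, one_mul, mul_one]
      linarith

theorem exists_flow (hr : 0 < r) (M : MeanFieldModel r) :
    ∃ (F : (Fin r → ℝ) → Fin r → Fin r → ℝ) (C : ℝ), 0 ≤ C ∧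
      (∀ i j, Continuous fun v => F v i j) ∧ (∀ v i j, 0 ≤ F v i j) ∧
      (∀ v i j, (i, j) ∉ M.E → F v i j = 0) ∧
      (∀ v, ∑ k, v k = 0 → ∀ k, ∑ i, F v i k - ∑ j, F v k j = v k) ∧
      (∀ v, (∀ k, |v k| ≤ 2) → ∀ i j, F v i j ≤ C) := by
  choose N n1 n2 n3 using exists_unitflow M
  set o : Fin r := ⟨0, hr⟩
  have n4 : ∀ (i j k : Fin r), 0 ≤ 2 * N o k i j + 2 * N k o i j := fun i j k => by
    have := n1 o k i j; have := n1 k o i j; linarith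
  refine ⟨fun v i j => ∑ k, (max (v k) 0 * N o k i j + max (-v k) 0 * N k o i j),
    ∑ i, ∑ j, ∑ k, (2 * N o k i j + 2 * N k o i j), ?_, ?_, ?_, ?_, ?_, ?_⟩
  · exact Finset.sum_nonneg fun i _ => Finset.sum_nonneg fun j _ => Finset.sum_nonneg fun k _ =>
      n4 i j k
  · intro i j; fun_prop
  · intro v i j
    exact Finset.sum_nonneg fun k _ => add_nonneg (mul_nonneg (le_max_right _ _) (n1 _ _ _ _))
      (mul_nonneg (le_max_right _ _) (n1 _ _ _ _))
  · intro v i j hij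
    exact Finset.sum_eq_zero fun k _ => by rw [n2 _ _ _ _ hij, n2 _ _ _ _ hij]; ring
  · intro v hv l
    dsimp only
    rw [Finset.sum_comm, Finset.sum_comm (f := fun j k => max (v k) 0 * N o k l j + max (-v k) 0 * N k o l j),
      ← Finset.sum_sub_distrib]
    have : ∀ k, (∑ i, (max (v k) 0 * N o k i l + max (-v k) 0 * N k o i l)
        - ∑ j, (max (v k) 0 * N o k l j + max (-v k) 0 * N k o l j))
        = v k * (if l = k then 1 else 0) - v k * (if l = o then 1 else 0) := by
      intro k
      have a1 := n3 o k l
      have a2 := n3 k o l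
      have a3 : max (v k) 0 - max (-v k) 0 = v k := by
        rcases le_total (v k) 0 with h | h
        · rw [max_eq_right h, max_eq_left (by linarith)]; ring
        · rw [max_eq_left h, max_eq_right (by linarith)]; ring
      simp only [Finset.sum_add_distrib, ← Finset.mul_sum]
      generalize max (v k) 0 = p at *
      generalize max (-v k) 0 = q at *
      rw [← a3]
      linear_combination p * a1 + q * a2
    rw [Finset.sum_congr rfl fun k _ => this k, Finset.sum_sub_distrib, ← Finset.sum_mul, hv]
    simp
  · intro v hv i j
    have h1 : ∑ k, (max (v k) 0 * N o k i j + max (-v k) 0 * N k o i j)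
        ≤ ∑ k, (2 * N o k i j + 2 * N k o i j) := by
      refine Finset.sum_le_sum fun k _ => ?_
      have := abs_le.1 (hv k)
      exact add_le_add (mul_le_mul_of_nonneg_right (max_le (by linarith) (by norm_num)) (n1 _ _ _ _))
        (mul_le_mul_of_nonneg_right (max_le (by linarith) (by norm_num)) (n1 _ _ _ _))
    refine h1.trans ?_
    refine le_trans ?_ (Finset.single_le_sum (f := fun i => ∑ j, ∑ k, (2 * N o k i j + 2 * N k o i j))
      (fun i _ => Finset.sum_nonneg fun j _ => Finset.sum_nonneg fun k _ => n4 i j k) (Finset.mem_univ i))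
    exact Finset.single_le_sum (f := fun j => ∑ k, (2 * N o k i j + 2 * N k o i j))
      (fun j _ => Finset.sum_nonneg fun k _ => n4 i j k) (Finset.mem_univ j)

theorem tau_bound {a m C a₀ Cb : ℝ} (ha₀ : 0 < a₀) (ha : a₀ ≤ a) (haC : a ≤ Cb) (hm : 0 ≤ m)
    (hmC : m ≤ C) : a * tauStar (m / a - 1) ≤ 2 * C * √(C / a₀) + Cb := by
  have ha' : 0 < a := ha₀.trans_le ha
  have hC : 0 ≤ C := hm.trans hmC
  have h1 : a * tauStar (m / a - 1) = m * Real.log (m / a) - m + a := by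
    unfold tauStar; rw [sub_add_cancel]; field_simp; ring
  have hx : 0 ≤ m / a := by positivity
  have h2 : Real.log (m / a) ≤ 2 * √(m / a) := by
    rw [← Real.sq_sqrt hx, Real.log_pow]
    have := Real.log_le_self (Real.sqrt_nonneg (m / a))
    rw [Real.sqrt_sq (Real.sqrt_nonneg _)]
    push_cast; linarith
  have h3 : √(m / a) ≤ √(C / a₀) := Real.sqrt_le_sqrt (by gcongr)
  have h4 : m * Real.log (m / a) ≤ C * (2 * √(C / a₀)) :=
    calc m * Real.log (m / a) ≤ m * (2 * √(C / a₀)) :=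
          mul_le_mul_of_nonneg_left (by linarith) hm
      _ ≤ _ := mul_le_mul_of_nonneg_right hmC (by positivity)
  rw [h1]; linarith

theorem sqrt_bound {t T : ℝ} (ht : 0 < t) (htT : t < T) :
    1 / √(t * (T - t) / T) ≤ t ^ (-(1/2) : ℝ) + (T - t) ^ (-(1/2) : ℝ) := by
  have hs : 0 < T - t := by linarith
  have hT : 0 < T := by linarith
  rw [Real.rpow_neg ht.le, Real.rpow_neg hs.le, ← Real.sqrt_eq_rpow, ← Real.sqrt_eq_rpow,
    Real.sqrt_div (by positivity), Real.sqrt_mul ht.le]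
  have h1 := Real.sqrt_pos.2 ht
  have h2 := Real.sqrt_pos.2 hs
  have h3 : √T ≤ √t + √(T - t) := by
    rw [Real.sqrt_le_left (by positivity)]
    nlinarith [Real.sq_sqrt ht.le, Real.sq_sqrt hs.le, mul_pos h1 h2]
  rw [one_div_div, inv_add_inv h1.ne' h2.ne']
  gcongr

theorem lint_bound {T A B : ℝ} (hT : 0 < T) (hT1 : T ≤ 1) (hA : 0 ≤ A) (hB : 0 ≤ B) :
    ∫⁻ t in Ioc (0 : ℝ) T, ENNReal.ofReal
      (A * (t ^ (-(1/2) : ℝ) + (T - t) ^ (-(1/2) : ℝ)) + B) ≤ ENNReal.ofReal ((4 * A + B) * √T) := by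
  have i0 : IntervalIntegrable (fun t : ℝ => t ^ (-(1/2) : ℝ)) volume 0 T :=
    intervalIntegral.intervalIntegrable_rpow' (by norm_num)
  have i1 : IntervalIntegrable (fun t : ℝ => (T - t) ^ (-(1/2) : ℝ)) volume 0 T := by
    have := (i0.comp_sub_left T).symm
    simpa using this
  have e0 : ∫ t in (0 : ℝ)..T, t ^ (-(1/2) : ℝ) = 2 * √T := by
    rw [integral_rpow (Or.inl (by norm_num)), Real.sqrt_eq_rpow]
    norm_num
    ring
  have e1 : ∫ t in (0 : ℝ)..T, (T - t) ^ (-(1/2) : ℝ) = 2 * √T := by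
    rw [intervalIntegral.integral_comp_sub_left (fun t : ℝ => t ^ (-(1/2) : ℝ)) T]
    simpa using e0
  have i2 : IntervalIntegrable (fun t : ℝ => A * (t ^ (-(1/2) : ℝ) + (T - t) ^ (-(1/2) : ℝ)) + B)
      volume 0 T := ((i0.add i1).const_mul A).add intervalIntegrable_const
  have hTs : T ≤ √T := by
    rw [Real.le_sqrt hT.le hT.le]; nlinarith
  rw [← ofReal_integral_eq_lintegral_ofReal]
  · apply ENNReal.ofReal_le_ofReal
    rw [← intervalIntegral.integral_of_le hT.le,
      intervalIntegral.integral_add ((i0.add i1).const_mul A) intervalIntegrable_const,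
      intervalIntegral.integral_const_mul, intervalIntegral.integral_add i0 i1, e0, e1]
    simp
    nlinarith
  · exact (intervalIntegrable_iff_integrableOn_Ioc_of_le hT.le).1 i2
  · refine (ae_restrict_iff' measurableSet_Ioc).2 (ae_of_all _ fun t ht => ?_)
    have := Real.rpow_nonneg ht.1.le (-(1/2))
    have := Real.rpow_nonneg (sub_nonneg.2 ht.2) (-(1/2))
    simp only [Pi.zero_apply]
    positivity

theorem local_conn (hr : 0 < r) (M : MeanFieldModel r) {ε : ℝ} (hε : 0 < ε) :
    ∃ δ > 0, ∀ ν ∈ stdSimplex ℝ (Fin r), ∀ ξ ∈ stdSimplex ℝ (Fin r), dist ν ξ ≤ δ →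
      ∃ T, 0 < T ∧ T ≤ 1 ∧ Conn M T ν ξ (ENNReal.ofReal ε) := by
  obtain ⟨F, C, hC, F1, F2, F3, F4, F5⟩ := exists_flow hr M
  have hr' : (0 : ℝ) < r := by exact_mod_cast hr
  have hr1 : (1 : ℝ) ≤ r := by exact_mod_cast hr
  set A : ℝ := M.E.card * (2 * C * √(C * r / M.c)) with hA
  set B : ℝ := M.E.card * |M.Cb| with hB
  have hA0 : 0 ≤ A := by positivity
  have hB0 : 0 ≤ B := by positivity
  set q : ℝ := min 1 (ε / (4 * A + B + 1)) with hq
  have hq0 : 0 < q := lt_min one_pos (by positivity)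
  have hq1 : q ≤ 1 := min_le_left _ _
  have hqε : (4 * A + B) * q ≤ ε := by
    have : q ≤ ε / (4 * A + B + 1) := min_le_right _ _
    rw [le_div_iff₀ (by positivity)] at this
    nlinarith
  set T : ℝ := q ^ 2 with hTdef
  have hT : 0 < T := by positivity
  have hT1 : T ≤ 1 := by nlinarith
  have hTq : √T = q := Real.sqrt_sq hq0.le
  refine ⟨T, hT, fun ν hν ξ hξ hd => ⟨T, hT, hT1, ?_⟩⟩
  have hdi : ∀ i, |ξ i - ν i| ≤ T := fun i => by
    have := dist_le_pi_dist ν ξ i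
    rw [dist_comm, Real.dist_eq] at this
    exact this.trans hd
  set φ : ℝ → ℝ := fun t => t * (T - t) / T with hφ
  set φ' : ℝ → ℝ := fun t => (T - 2 * t) / T with hφ'
  set x : ℝ → Fin r → ℝ := fun t i => ν i + t / T * (ξ i - ν i) with hx
  set μ : ℝ → Fin r → ℝ := fun t i => (1 - φ t) * x t i + φ t / r with hμ
  set v : ℝ → Fin r → ℝ := fun t i => φ' t * (1 / r - x t i) + (1 - φ t) * ((ξ i - ν i) / T) with hv
  have hφd : ∀ t, HasDerivAt φ (φ' t) t := by
    intro t
    have := (((hasDerivAt_id t).mul ((hasDerivAt_id t).const_sub T)).div_const T)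
    refine this.congr_deriv ?_
    simp only [hφ', id]; ring
  have hxd : ∀ t i, HasDerivAt (fun t => x t i) ((ξ i - ν i) / T) t := by
    intro t i
    have := (((hasDerivAt_id t).div_const T).mul_const (ξ i - ν i)).const_add (ν i)
    refine this.congr_deriv ?_
    ring
  have hμd : ∀ t i, HasDerivAt (fun t => μ t i) (v t i) t := by
    intro t i
    have := (((hφd t).const_sub 1).mul (hxd t i)).add ((hφd t).div_const (r : ℝ))
    refine this.congr_deriv ?_
    simp only [hv]; ring
  have hφc : Continuous φ := by simp only [hφ]; fun_prop
  have hxc : ∀ i, Continuous fun t => x t i := fun i => by simp only [hx]; fun_prop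
  have hμc : ∀ i, Continuous fun t => μ t i := fun i => by
    have := hxc i; simp only [hμ]; fun_prop
  have hvc : Continuous v := by
    refine continuous_pi fun i => ?_
    have := hxc i; simp only [hv, hφ']; fun_prop
  have hν1 : ∑ i, ν i = 1 := hν.2
  have hξ1 : ∑ i, ξ i = 1 := hξ.2
  have hxs : ∀ t, ∑ i, x t i = 1 := by
    intro t
    simp only [hx, Finset.sum_add_distrib, ← Finset.mul_sum, Finset.sum_sub_distrib, hν1, hξ1]
    ring
  have hμs : ∀ t, ∑ i, μ t i = 1 := by
    intro t
    simp only [hμ, Finset.sum_add_distrib, ← Finset.mul_sum, hxs]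
    simp only [Finset.sum_const, Finset.card_univ, Fintype.card_fin, nsmul_eq_mul]
    field_simp; ring
  have hvs : ∀ t, ∑ i, v t i = 0 := by
    intro t
    simp only [hv, Finset.sum_add_distrib, ← Finset.mul_sum, Finset.sum_sub_distrib, hxs,
      ← Finset.sum_div, hν1, hξ1]
    simp only [Finset.sum_const, Finset.card_univ, Fintype.card_fin, nsmul_eq_mul]
    field_simp; ring
  have hx0 : ∀ t ∈ Icc 0 T, ∀ i, 0 ≤ x t i := by
    intro t ht i
    have h1 : 0 ≤ t / T := div_nonneg ht.1 hT.le
    have h2 : t / T ≤ 1 := (div_le_one hT).2 ht.2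
    have h3 := hν.1 i
    have h4 := hξ.1 i
    have : x t i = (1 - t / T) * ν i + t / T * ξ i := by simp only [hx]; ring
    rw [this]
    exact add_nonneg (mul_nonneg (by linarith) h3) (mul_nonneg h1 h4)
  have hx1 : ∀ t ∈ Icc 0 T, ∀ i, x t i ≤ 1 := by
    intro t ht i
    rw [← hxs t]
    exact Finset.single_le_sum (fun j _ => hx0 t ht j) (Finset.mem_univ i)
  have hφ0 : ∀ t ∈ Icc 0 T, 0 ≤ φ t := fun t ht =>
    div_nonneg (mul_nonneg ht.1 (by linarith [ht.2])) hT.le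
  have hφ1 : ∀ t ∈ Icc 0 T, φ t ≤ 1 := fun t ht => by
    simp only [hφ]
    rw [div_le_one hT]
    nlinarith [ht.1, ht.2]
  have hμlow : ∀ t ∈ Icc 0 T, ∀ i, φ t / r ≤ μ t i := by
    intro t ht i
    have := mul_nonneg (sub_nonneg.2 (hφ1 t ht)) (hx0 t ht i)
    simp only [hμ]; linarith
  have hμ0 : ∀ t ∈ Icc 0 T, ∀ i, 0 ≤ μ t i := fun t ht i =>
    (div_nonneg (hφ0 t ht) hr'.le).trans (hμlow t ht i)
  have hμ1 : ∀ t ∈ Icc 0 T, ∀ i, μ t i ≤ 1 := by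
    intro t ht i
    rw [← hμs t]
    exact Finset.single_le_sum (fun j _ => hμ0 t ht j) (Finset.mem_univ i)
  have hsimp : ∀ t ∈ Icc 0 T, μ t ∈ stdSimplex ℝ (Fin r) := fun t ht => ⟨hμ0 t ht, hμs t⟩
  have hφpos : ∀ t ∈ Ioo 0 T, 0 < φ t := fun t ht =>
    div_pos (mul_pos ht.1 (by linarith [ht.2])) hT
  have hμpos : ∀ t ∈ Ioo 0 T, ∀ i, 0 < μ t i := fun t ht i =>
    (div_pos (hφpos t ht) hr').trans_le (hμlow t (Ioo_subset_Icc_self ht) i)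
  have hvb : ∀ t ∈ Icc 0 T, ∀ i, |v t i| ≤ 2 := by
    intro t ht i
    have a1 : |φ' t| ≤ 1 := by
      simp only [hφ']
      rw [abs_div, abs_of_pos hT, div_le_one hT, abs_le]
      constructor <;> linarith [ht.1, ht.2]
    have a2 : |1 / (r : ℝ) - x t i| ≤ 1 := by
      have b1 : 0 < 1 / (r : ℝ) := by positivity
      have b2 : 1 / (r : ℝ) ≤ 1 := (div_le_one hr').2 hr1
      have b3 := hx0 t ht i
      have b4 := hx1 t ht i
      rw [abs_le]; constructor <;> linarith
    have a3 : |1 - φ t| ≤ 1 := by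
      have b3 := hφ0 t ht
      have b4 := hφ1 t ht
      rw [abs_le]; constructor <;> linarith
    have a4 : |(ξ i - ν i) / T| ≤ 1 := by
      rw [abs_div, abs_of_pos hT, div_le_one hT]; exact hdi i
    have a5 : |φ' t * (1 / r - x t i)| ≤ 1 := by
      rw [abs_mul]; exact mul_le_one₀ a1 (abs_nonneg _) a2
    have a6 : |(1 - φ t) * ((ξ i - ν i) / T)| ≤ 1 := by
      rw [abs_mul]; exact mul_le_one₀ a3 (abs_nonneg _) a4
    have := abs_add_le (φ' t * (1 / r - x t i)) ((1 - φ t) * ((ξ i - ν i) / T))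
    simp only [hv]; linarith
  set L : ℝ → Fin r → Fin r → ℝ := fun t i j =>
    if j = i then -∑ k, F (v t) i k / |μ t i| else F (v t) i j / |μ t i| with hL
  have Fd : ∀ w i, F w i i = 0 := fun w i => F3 w i i (M.no_diag i)
  have hFm : ∀ i j, Measurable fun t => F (v t) i j := fun i j =>
    ((F1 i j).comp hvc).measurable
  have hFL : ∀ i j, Measurable fun t => F (v t) i j / |μ t i| := fun i j =>
    (hFm i j).div (hμc i).abs.measurable
  have hLv : ∀ t ∈ Ioo 0 T, ∀ i, ∑ j, L t j i * μ t j = v t i := by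
    intro t ht i
    have : ∀ j, L t j i * μ t j = F (v t) j i - (if j = i then ∑ k, F (v t) i k else 0) := by
      intro j
      have hp := hμpos t ht j
      simp only [hL]
      rw [abs_of_pos hp]
      by_cases hji : j = i
      · subst hji
        simp only [if_true, ← Finset.sum_div, Fd]
        field_simp; ring
      · rw [if_neg (Ne.symm hji), if_neg hji]
        field_simp; ring
    rw [Finset.sum_congr rfl fun j _ => this j, Finset.sum_sub_distrib]
    simp only [Finset.sum_ite_eq', Finset.mem_univ, if_true]
    exact F4 _ (hvs t) i
  have hae : ∀ t ≤ T, ∀ i, (fun s => ∑ j, L s j i * μ s j) =ᵐ[volume.restrict (Ioc 0 t)]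
      fun s => v s i := by
    intro t ht i
    rw [← restrict_Ioo_eq_restrict_Ioc]
    refine (ae_restrict_iff' measurableSet_Ioo).2 (ae_of_all _ fun s hs => ?_)
    exact hLv s ⟨hs.1, hs.2.trans_le ht⟩ i
  have hvci : ∀ i, Continuous fun t => v t i := fun i => (continuous_apply i).comp hvc
  refine ⟨μ, L, ⟨?_, ?_, ?_, ?_⟩, ⟨?_, ?_⟩, ?_, ?_, hsimp, ?_⟩
  · intro i j
    simp only [hL]
    by_cases hji : j = i
    · simp only [hji, if_true]
      exact (Finset.measurable_sum _ fun k _ => hFL i k).neg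
    · simp only [hji, if_false]
      exact hFL i j
  · intro t i j hij
    simp only [hL, if_neg (Ne.symm hij)]
    exact div_nonneg (F2 _ _ _) (abs_nonneg _)
  · intro t i j hij hE
    simp only [hL, if_neg (Ne.symm hij), F3 _ _ _ hE, zero_div]
  · intro t i
    have e : ∑ j ∈ Finset.univ.filter (fun j => j ≠ i), L t i j
        = ∑ j, F (v t) i j / |μ t i| := by
      rw [Finset.sum_filter]
      refine Finset.sum_congr rfl fun j _ => ?_
      by_cases hji : j = i
      · simp [hji, Fd]
      · simp [hL, hji]
    rw [e]; simp [hL]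
  · intro i
    rw [integrableOn_Icc_iff_integrableOn_Ioc]
    refine Integrable.congr ?_ (hae T le_rfl i).symm
    exact ((hvci i).integrableOn_Icc).mono_set Ioc_subset_Icc_self
  · intro t ht i
    rw [integral_congr_ae (hae t ht.2 i), ← intervalIntegral.integral_of_le ht.1,
      intervalIntegral.integral_eq_sub_of_hasDerivAt (fun s _ => hμd s i)
        ((hvci i).intervalIntegrable _ _)]
    ring
  · funext i; simp [hμ, hφ, hx]
  · funext i
    simp [hμ, hφ, hx, hT.ne']
  · refine le_trans ?_ ((lint_bound hT hT1 hA0 hB0).trans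
      (ENNReal.ofReal_le_ofReal (by rw [hTq]; exact hqε)))
    unfold runningCost
    refine lintegral_mono_ae ?_
    rw [← restrict_Ioo_eq_restrict_Ioc]
    refine (ae_restrict_iff' measurableSet_Ioo).2 (ae_of_all _ fun t ht => ?_)
    have ht' := Ioo_subset_Icc_self ht
    apply ENNReal.ofReal_le_ofReal
    have key : ∀ p ∈ M.E, μ t p.1 * M.lam p.1 p.2 (μ t) *
        tauStar (L t p.1 p.2 / M.lam p.1 p.2 (μ t) - 1) ≤
        2 * C * √(C * r / M.c) * (1 / √(φ t)) + |M.Cb| := by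
      intro p hp
      have hne : p.2 ≠ p.1 := by
        intro h
        have : p = (p.1, p.1) := Prod.ext rfl h
        exact M.no_diag p.1 (this ▸ hp)
      have l1 := M.lam_lower p hp (μ t) (hsimp t ht')
      have l2 := M.lam_upper p hp (μ t) (hsimp t ht')
      have hc := M.c_pos
      have hp1 := hμpos t ht p.1
      have hl : 0 < M.lam p.1 p.2 (μ t) := hc.trans_le l1
      have e : L t p.1 p.2 / M.lam p.1 p.2 (μ t)
          = F (v t) p.1 p.2 / (μ t p.1 * M.lam p.1 p.2 (μ t)) := by
        simp only [hL, if_neg hne, abs_of_pos hp1, div_div]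
      rw [e]
      have hφp := hφpos t ht
      have := tau_bound (a := μ t p.1 * M.lam p.1 p.2 (μ t)) (m := F (v t) p.1 p.2) (C := C)
        (a₀ := φ t / r * M.c) (Cb := |M.Cb|) (by positivity)
        (mul_le_mul (hμlow t ht' p.1) l1 hc.le hp1.le)
        ((mul_le_of_le_one_left hl.le (hμ1 t ht' p.1)).trans (l2.trans (le_abs_self _)))
        (F2 _ _ _) (F5 _ (hvb t ht') _ _)
      have e2 : √(C / (φ t / r * M.c)) = √(C * r / M.c) * (1 / √(φ t)) := by
        rw [← Real.sqrt_one, ← Real.sqrt_div zero_le_one, ← Real.sqrt_mul (by positivity)]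
        congr 1; field_simp
      rw [e2] at this
      linarith
    refine (Finset.sum_le_card_nsmul _ _ _ key).trans ?_
    rw [nsmul_eq_mul, mul_add, ← mul_assoc, ← hA, ← hB]
    have := mul_le_mul_of_nonneg_left (sqrt_bound ht.1 ht.2) hA0
    linarith

/-- for any `ε > 0` and any compact `K ⊆ M₁(Z)` there is `T₀ < ∞`
such that any `ν, ξ ∈ K` can be joined in some time `T ≤ T₀` by an absolutely
continuous path of cost at most `V(ξ|ν) + ε`. -/
theorem stmt6 (r : ℕ) (hr : 0 < r) (M : MeanFieldModel r) (ε : ℝ) (hε : 0 < ε)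
    (K : Set (Fin r → ℝ)) (hK : IsCompact K) (hKs : K ⊆ stdSimplex ℝ (Fin r)) :
    ∃ T₀ : ℝ, ∀ ν ∈ K, ∀ ξ ∈ K, ∃ T : ℝ, 0 < T ∧ T ≤ T₀ ∧
      ∃ μ : ℝ → Fin r → ℝ, μ 0 = ν ∧ μ T = ξ ∧
        SPath M T ν μ ≤ quasipotential M ν ξ + ENNReal.ofReal ε := by
  obtain ⟨δ, hδ, hloc⟩ := local_conn hr M (show 0 < ε / 6 by positivity)
  set e : ℝ≥0∞ := ENNReal.ofReal (ε / 6) with he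
  have he0 : e ≠ 0 := by simp [he, hε]
  have h6 : ENNReal.ofReal ε = e + e + e + e + e + e := by
    simp only [he]
    repeat rw [← ENNReal.ofReal_add (by positivity) (by positivity)]
    congr 1; ring
  have hex : ∀ x : (Fin r → ℝ) × (Fin r → ℝ), ∃ T, 0 < T ∧
      (quasipotential M x.1 x.2 ≠ ⊤ → Conn M T x.1 x.2 (quasipotential M x.1 x.2 + e)) := by
    intro x
    by_cases hx : quasipotential M x.1 x.2 = ⊤
    · exact ⟨1, one_pos, fun h => absurd hx h⟩
    · obtain ⟨T, hT, h⟩ := conn_of_quasi_lt (ENNReal.lt_add_right hx he0)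
      exact ⟨T, hT, fun _ => h⟩
  choose τ hτ0 hτ using hex
  obtain ⟨t, htK, htf, htc⟩ := (hK.prod hK).finite_cover_balls hδ
  obtain ⟨B, hB⟩ := (htf.image τ).bddAbove
  refine ⟨max 1 (B + 2), fun ν hν ξ hξ => ?_⟩
  by_cases hV : quasipotential M ν ξ = ⊤
  · exact ⟨1, one_pos, le_max_left _ _, fun s => if s = 0 then ν else ξ, by simp, by simp,
      by simp [hV]⟩
  have hmem := htc (show (ν, ξ) ∈ K ×ˢ K from ⟨hν, hξ⟩)
  simp only [mem_iUnion, Metric.mem_ball] at hmem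
  obtain ⟨⟨ν', ξ'⟩, hx, hd⟩ := hmem
  rw [Prod.dist_eq, max_lt_iff] at hd
  obtain ⟨d1, d2⟩ := hd
  dsimp only at d1 d2
  have hνs := hKs hν
  have hξs := hKs hξ
  have hν's := hKs (htK hx).1
  have hξ's := hKs (htK hx).2
  obtain ⟨T1, p1, q1, c1⟩ := hloc ν hνs ν' hν's d1.le
  obtain ⟨T2, p2, q2, c2⟩ := hloc ν' hν's ν hνs (by rw [dist_comm]; exact d1.le)
  obtain ⟨T3, p3, q3, c3⟩ := hloc ξ hξs ξ' hξ's d2.le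
  obtain ⟨T4, p4, q4, c4⟩ := hloc ξ' hξ's ξ hξs (by rw [dist_comm]; exact d2.le)
  obtain ⟨T5, p5, c5⟩ := conn_of_quasi_lt (ENNReal.lt_add_right hV he0)
  have hle := ((c2.trans c5 p2 p5).trans c3 (by linarith) p3).quasi_le (by linarith)
  have hV' : quasipotential M ν' ξ' ≠ ⊤ := by
    refine ne_top_of_le_ne_top ?_ hle
    simp [he, hV]
  have c6 := hτ (ν', ξ') hV'
  have p6 := hτ0 (ν', ξ')
  have q6 : τ (ν', ξ') ≤ B := hB (mem_image_of_mem τ hx)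
  have c7 := (c1.trans c6 p1 p6).trans c4 (by linarith) p4
  refine ⟨_, ?_, ?_, (c7.mono ?_).path⟩
  · linarith
  · refine le_trans ?_ (le_max_right _ _)
    linarith
  · calc e + (quasipotential M ν' ξ' + e) + e
        ≤ e + ((e + (quasipotential M ν ξ + e) + e) + e) + e := by gcongr
      _ = quasipotential M ν ξ + ENNReal.ofReal ε := by rw [h6]; ring
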